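/- Under the context hypotheses, if in addition b₀ < 0, then for all (t,x) ∈ [0,T*) × ℝ^d: a₀ · exp(C ∫₀ᵗ D(t') dt') ≤ f(t,x) ≤ b₀ · exp(−C ∫₀ᵗ D(t') dt'). -/

import Mathlib

open MeasureTheory
open scoped ENNReal BigOperators

/-- The (spatial) divergence of a vector field `w : ℝ^d → ℝ^d`:
`div w (x) = ∑ i ∂_{x_i} w_i (x)`. -/
noncomputable def divg {d : ℕ} (w : EuclideanSpace ℝ (Fin d) → EuclideanSpace ℝ (Fin d))
    (x : EuclideanSpace ℝ (Fin d)) : ℝ :=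
  ∑ i : Fin d, fderiv ℝ w x (EuclideanSpace.single i 1) i

/-- Removing the regularization `ε` from a logarithmic comparison of two squares. -/
theorem abs_le_abs_mul_exp_of_log_sq_add_sub_le {a b I : ℝ}
    (h : ∀ ε : ℝ, 0 < ε → Real.log (a ^ 2 + ε) - Real.log (b ^ 2 + ε) ≤ 2 * I) :
    |a| ≤ |b| * Real.exp I := by
  have key : a ^ 2 ≤ b ^ 2 * Real.exp (2 * I) := by
    refine le_of_forall_pos_le_add fun δ hδ => ?_
    have hE := Real.exp_pos (2 * I)
    have hε : 0 < δ / Real.exp (2 * I) := div_pos hδ hE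
    have ha : 0 < a ^ 2 + δ / Real.exp (2 * I) := by positivity
    have hb : 0 < b ^ 2 + δ / Real.exp (2 * I) := by positivity
    have h1 : Real.log (a ^ 2 + δ / Real.exp (2 * I)) ≤
        Real.log ((b ^ 2 + δ / Real.exp (2 * I)) * Real.exp (2 * I)) := by
      rw [Real.log_mul hb.ne' hE.ne', Real.log_exp]
      linarith [h _ hε]
    have h2 := (Real.log_le_log_iff ha (mul_pos hb hE)).1 h1
    rw [add_mul, div_mul_cancel₀ _ hE.ne'] at h2
    linarith
  refine abs_le_of_sq_le_sq ?_ (by positivity)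
  rwa [mul_pow, sq_abs, ← Real.exp_nat_mul, Nat.cast_ofNat]

/-- Two-sided Grönwall estimate for the linear differential inequality `|g'| ≤ φ |g|` with an
integrable coefficient `φ`. -/
theorem abs_bounds_of_abs_deriv_right_le {g g' φ : ℝ → ℝ} {a b : ℝ} (hab : a ≤ b)
    (hg : ContinuousOn g (Set.Icc a b))
    (hg' : ∀ s ∈ Set.Ico a b, HasDerivWithinAt g (g' s) (Set.Ioi s) s)
    (hφ : IntegrableOn φ (Set.Icc a b))
    (hbound : ∀ s ∈ Set.Ico a b, |g' s| ≤ φ s * |g s|) (hφ0 : ∀ s ∈ Set.Ico a b, 0 ≤ φ s) :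
    |g b| ≤ |g a| * Real.exp (∫ s in a..b, φ s) ∧
      |g a| ≤ |g b| * Real.exp (∫ s in a..b, φ s) := by
  have hcont : ∀ ε : ℝ, 0 < ε →
      ContinuousOn (fun s => Real.log (g s ^ 2 + ε)) (Set.Icc a b) := fun ε hε =>
    ((hg.pow 2).add continuousOn_const).log fun s _ =>
      (add_pos_of_nonneg_of_pos (sq_nonneg (g s)) hε).ne'
  have hderiv : ∀ ε : ℝ, 0 < ε → ∀ s ∈ Set.Ico a b,
      HasDerivWithinAt (fun s => Real.log (g s ^ 2 + ε))
        (2 * g s * g' s / (g s ^ 2 + ε)) (Set.Ioi s) s := fun ε hε s hs => by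
    have h := (((hg' s hs).pow 2).add_const ε).log
      (add_pos_of_nonneg_of_pos (sq_nonneg (g s)) hε).ne'
    simpa using h
  have hle : ∀ ε : ℝ, 0 < ε → ∀ s ∈ Set.Ico a b,
      |2 * g s * g' s / (g s ^ 2 + ε)| ≤ 2 * φ s := fun ε hε s hs => by
    have hpos : 0 < g s ^ 2 + ε := by positivity
    rw [abs_div, abs_of_pos hpos, div_le_iff₀ hpos, abs_mul, abs_mul, abs_two]
    have h1 := mul_le_mul_of_nonneg_left (hbound s hs) (abs_nonneg (g s))
    nlinarith [sq_abs (g s), mul_nonneg (hφ0 s hs) hε.le]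
  constructor <;> refine abs_le_abs_mul_exp_of_log_sq_add_sub_le fun ε hε => ?_ <;>
    rw [← intervalIntegral.integral_const_mul]
  · exact intervalIntegral.sub_le_integral_of_hasDeriv_right_of_le hab (hcont ε hε)
      (fun s hs => hderiv ε hε s ⟨hs.1.le, hs.2⟩) (hφ.const_mul 2)
      fun s hs => (abs_le.1 (hle ε hε s ⟨hs.1.le, hs.2⟩)).2
  · have h := intervalIntegral.sub_le_integral_of_hasDeriv_right_of_le hab (hcont ε hε).neg
      (fun s hs => (hderiv ε hε s ⟨hs.1.le, hs.2⟩).neg) (hφ.const_mul 2)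
      fun s hs => neg_le.1 (abs_le.1 (hle ε hε s ⟨hs.1.le, hs.2⟩)).1
    simpa only [Pi.neg_apply, neg_sub_neg] using h

/-- If `g` starts negative and `|g'| ≤ φ |g|`, then `g` stays negative and changes by at most
the factor `exp (∫ φ)`. -/
theorem bounds_of_neg_of_abs_deriv_right_le {g g' φ : ℝ → ℝ} {a b : ℝ} (hab : a ≤ b)
    (hg : ContinuousOn g (Set.Icc a b))
    (hg' : ∀ s ∈ Set.Ico a b, HasDerivWithinAt g (g' s) (Set.Ioi s) s)
    (hφ : IntegrableOn φ (Set.Icc a b))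
    (hbound : ∀ s ∈ Set.Ico a b, |g' s| ≤ φ s * |g s|) (hφ0 : ∀ s ∈ Set.Ico a b, 0 ≤ φ s)
    (hga : g a < 0) :
    g a * Real.exp (∫ s in a..b, φ s) ≤ g b ∧
      g b ≤ g a * Real.exp (-∫ s in a..b, φ s) := by
  have hne : ∀ s ∈ Set.Icc a b, g s ≠ 0 := fun s hs h0 => by
    have hsub : Set.Ico a s ⊆ Set.Ico a b := Set.Ico_subset_Ico_right hs.2
    have h := (abs_bounds_of_abs_deriv_right_le hs.1
      (hg.mono (Set.Icc_subset_Icc_right hs.2)) (fun r hr => hg' r (hsub hr))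
      (hφ.mono_set (Set.Icc_subset_Icc_right hs.2)) (fun r hr => hbound r (hsub hr))
      fun r hr => hφ0 r (hsub hr)).2
    rw [h0, abs_zero, zero_mul] at h
    exact absurd (abs_pos.2 hga.ne) h.not_gt
  have hgb : g b < 0 := by
    by_contra! hgb
    obtain ⟨s, hs, h0⟩ := intermediate_value_Icc hab hg ⟨hga.le, hgb⟩
    exact hne s hs h0
  obtain ⟨h1, h2⟩ := abs_bounds_of_abs_deriv_right_le hab hg hg' hφ hbound hφ0
  rw [abs_of_neg hga, abs_of_neg hgb] at h1 h2
  refine ⟨by linarith, ?_⟩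
  rw [Real.exp_neg, ← div_eq_mul_inv, le_div_iff₀ (Real.exp_pos _)]
  linarith

/-- Differentiation along a curve: the total derivative of `s ↦ f s (c s)` is the sum of the
partial derivative in time and the spatial derivative in the direction of `c'`. -/
theorem hasDerivWithinAt_along_curve {E : Type*} [NormedAddCommGroup E] [NormedSpace ℝ E]
    {f : ℝ → E → ℝ} {A : Set ℝ} {s p : ℝ} {c : ℝ → E} {w : E}
    (hA : UniqueDiffWithinAt ℝ A s) (hs : s ∈ A)
    (hf : DifferentiableWithinAt ℝ (Function.uncurry f) (A ×ˢ Set.univ) (s, c s))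
    (hc : HasDerivWithinAt c w A s) (hp : HasDerivWithinAt (fun r => f r (c s)) p A s) :
    HasDerivWithinAt (fun r => f r (c r)) (p + fderiv ℝ (f s) (c s) w) A s := by
  obtain ⟨F, hF⟩ := hf
  have htime : F (1, 0) = p := by
    refine hA.eq_deriv A ?_ hp
    exact hF.comp_hasDerivWithinAt (f := fun r => (r, c s)) s
      ((hasDerivWithinAt_id s A).prodMk (hasDerivWithinAt_const s A (c s)))
      fun r hr => ⟨hr, Set.mem_univ _⟩
  have hspace : fderiv ℝ (f s) (c s) = F.comp (ContinuousLinearMap.inr ℝ ℝ E) := by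
    refine HasFDerivAt.fderiv (hasFDerivWithinAt_univ.1 ?_)
    exact hF.comp (f := fun y => (s, y)) (c s) (hasFDerivAt_prodMk_right s (c s)).hasFDerivWithinAt
      fun y _ => ⟨hs, Set.mem_univ _⟩
  have hsum : p + fderiv ℝ (f s) (c s) w = F (1, w) := by
    rw [hspace, ← htime, ContinuousLinearMap.comp_apply, ContinuousLinearMap.inr_apply, ← map_add]
    simp
  rw [hsum]
  exact hF.comp_hasDerivWithinAt (f := fun r => (r, c r)) s
    ((hasDerivWithinAt_id s A).prodMk hc) fun r hr => ⟨hr, Set.mem_univ _⟩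

/-- **Statement 16.** (Maximum principle for a transport equation, negative case.)
Let `d ≥ 2`, `T* ∈ (0,∞]`, `C > 0`, `a₀ < b₀` and let `ϑ : ℝ → ℝ` satisfy `|ϑ(x)| ≤ C|x|`.
Let `v` be a continuous time-dependent vector field on `[0,T*) × ℝ^d`, `C¹` and Lipschitz in
space, with divergence bounded by a locally integrable function `D ≥ 0`, and let `χ` be a
surjective flow map for `v`.  Let `f` be continuously differentiable and solve the transport
equation `∂_t f + ϑ(f)·div v + v·∇f = 0` with `a₀ ≤ f(0,·) ≤ b₀`.  If `b₀ < 0`, then for all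
`(t,x) ∈ [0,T*) × ℝ^d`:
`a₀ · exp(C ∫₀ᵗ D) ≤ f(t,x) ≤ b₀ · exp(−C ∫₀ᵗ D)`. -/
theorem stmt17 {d : ℕ} (hd : 2 ≤ d) (T : ℝ≥0∞) (hT : 0 < T)
    (C a₀ b₀ : ℝ) (hC : 0 < C) (hab : a₀ < b₀)
    (ϑ : ℝ → ℝ) (hϑ : ∀ x : ℝ, |ϑ x| ≤ C * |x|)
    (v : ℝ → EuclideanSpace ℝ (Fin d) → EuclideanSpace ℝ (Fin d))
    (L D : ℝ → ℝ)
    (hv_cont : ContinuousOn (Function.uncurry v)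
      (({s : ℝ | 0 ≤ s ∧ ENNReal.ofReal s < T}) ×ˢ
        (Set.univ : Set (EuclideanSpace ℝ (Fin d)))))
    (hv_smooth : ∀ t : ℝ, 0 ≤ t → ENNReal.ofReal t < T → ContDiff ℝ 1 (v t))
    (hv_lip : ∀ t : ℝ, 0 ≤ t → ENNReal.ofReal t < T →
      LipschitzWith (Real.toNNReal (L t)) (v t))
    (hD_bound : ∀ t : ℝ, 0 ≤ t → ENNReal.ofReal t < T → ∀ x, |divg (v t) x| ≤ D t)
    (hD0 : ∀ t : ℝ, 0 ≤ t → ENNReal.ofReal t < T → 0 ≤ D t)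
    (hLint : ∀ t : ℝ, 0 ≤ t → ENNReal.ofReal t < T → IntegrableOn L (Set.Icc 0 t))
    (hDint : ∀ t : ℝ, 0 ≤ t → ENNReal.ofReal t < T → IntegrableOn D (Set.Icc 0 t))
    (χ : ℝ → EuclideanSpace ℝ (Fin d) → EuclideanSpace ℝ (Fin d))
    (hχcont : ∀ x, ContinuousOn (fun s => χ s x) {s : ℝ | 0 ≤ s ∧ ENNReal.ofReal s < T})
    (hχ0 : ∀ x, χ 0 x = x)
    (hχ : ∀ x, ∀ t : ℝ, 0 ≤ t → ENNReal.ofReal t < T →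
      HasDerivWithinAt (fun s => χ s x) (v t (χ t x)) (Set.Ici 0) t)
    (hχsurj : ∀ t : ℝ, 0 ≤ t → ENNReal.ofReal t < T → Function.Surjective (χ t))
    (f : ℝ → EuclideanSpace ℝ (Fin d) → ℝ)
    (hf_smooth : ContDiffOn ℝ 1 (Function.uncurry f)
      (({s : ℝ | 0 ≤ s ∧ ENNReal.ofReal s < T}) ×ˢ
        (Set.univ : Set (EuclideanSpace ℝ (Fin d)))))
    (hf_pde : ∀ x, ∀ t : ℝ, 0 ≤ t → ENNReal.ofReal t < T →
      HasDerivWithinAt (fun s => f s x)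
        (-(ϑ (f t x) * divg (v t) x + fderiv ℝ (f t) x (v t x))) (Set.Ici 0) t)
    (hf_init : ∀ x, a₀ ≤ f 0 x ∧ f 0 x ≤ b₀)
    (hb₀ : b₀ < 0)
    (t : ℝ) (ht0 : 0 ≤ t) (htT : ENNReal.ofReal t < T)
    (x : EuclideanSpace ℝ (Fin d)) :
    a₀ * Real.exp (C * ∫ s in (0:ℝ)..t, D s) ≤ f t x ∧
      f t x ≤ b₀ * Real.exp (-(C * ∫ s in (0:ℝ)..t, D s)) := by
  obtain ⟨y, rfl⟩ := hχsurj t ht0 htT x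
  have hT' : ∀ s ≤ t, ENNReal.ofReal s < T := fun s hs =>
    (ENNReal.ofReal_le_ofReal hs).trans_lt htT
  have hsub : Set.Icc 0 t ⊆ {s : ℝ | 0 ≤ s ∧ ENNReal.ofReal s < T} := fun s hs =>
    ⟨hs.1, hT' s hs.2⟩
  have hcont : ContinuousOn (fun s => f s (χ s y)) (Set.Icc 0 t) :=
    hf_smooth.continuousOn.comp (continuousOn_id.prodMk ((hχcont y).mono hsub))
      fun s hs => ⟨hsub hs, Set.mem_univ _⟩
  have hderiv : ∀ s ∈ Set.Ico 0 t, HasDerivWithinAt (fun r => f r (χ r y))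
      (-(ϑ (f s (χ s y)) * divg (v s) (χ s y))) (Set.Ioi s) s := fun s hs => by
    have hsT := hT' s hs.2.le
    have hmem : s ∈ Set.Icc s t := Set.left_mem_Icc.2 hs.2.le
    have hst : Set.Icc s t ⊆ Set.Icc 0 t := Set.Icc_subset_Icc_left hs.1
    have hIci : Set.Icc s t ⊆ Set.Ici 0 := fun r hr => (hst hr).1
    have h := hasDerivWithinAt_along_curve (uniqueDiffOn_Icc hs.2 s hmem) hmem
      (((hf_smooth.differentiableOn one_ne_zero) (s, χ s y)
        ⟨⟨hs.1, hsT⟩, Set.mem_univ _⟩).mono (Set.prod_mono (hst.trans hsub) subset_rfl))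
      ((hχ y s hs.1 hsT).mono hIci) ((hf_pde (χ s y) s hs.1 hsT).mono hIci)
    rw [neg_add, neg_add_cancel_right] at h
    exact h.mono_of_mem_nhdsWithin (Icc_mem_nhdsGT hs.2)
  have hbound : ∀ s ∈ Set.Ico 0 t, |-(ϑ (f s (χ s y)) * divg (v s) (χ s y))| ≤
      C * D s * |f s (χ s y)| := fun s hs => by
    rw [abs_neg, abs_mul, mul_right_comm]
    exact mul_le_mul (hϑ _) (hD_bound s hs.1 (hT' s hs.2.le) _) (abs_nonneg _) (by positivity)
  have hinit := hf_init y
  obtain ⟨hlow, hup⟩ := bounds_of_neg_of_abs_deriv_right_le ht0 hcont hderiv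
    ((hDint t ht0 htT).const_mul C) hbound
    (fun s hs => mul_nonneg hC.le (hD0 s hs.1 (hT' s hs.2.le)))
    (by rw [hχ0]; exact hinit.2.trans_lt hb₀)
  rw [hχ0, intervalIntegral.integral_const_mul] at hlow hup
  exact ⟨(mul_le_mul_of_nonneg_right hinit.1 (Real.exp_pos _).le).trans hlow,
    hup.trans (mul_le_mul_of_nonneg_right hinit.2 (Real.exp_pos _).le)⟩
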